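/- Consider the pseudo-Riemannian metric of signature (3,3) on ℝ⁶ given by g = 2dx₁⊗dx₄ + 2dx₂⊗dx₅ + 2dx₃⊗dx₆ − 2x₁x₄ dx₁⊗dx₁ − 4x₃x₄ dx₁⊙dx₂ + 4x₂x₄ dx₁⊙dx₃ (the Riemannian extension of the affine Szabó connection ∇_{∂₁}∂₁ = x₁∂₁, ∇_{∂₁}∂₂ = 2x₃∂₁, ∇_{∂₁}∂₃ = −2x₂∂₁ on ℝ³). Then g is a Szabó metric: for every tangent vector X, the Szabó operator Y ↦ (∇^g_X R^g)(Y,X)X is nilpotent. -/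

import Mathlib

open scoped BigOperators

noncomputable section AffineSzabo

variable {ι : Type} [Fintype ι] [DecidableEq ι]

/-- Points of the coordinate chart. -/
abbrev Pt (ι : Type) := ι → ℝ
/-- Vector fields in coordinates. -/
abbrev VF (ι : Type) := Pt ι → Pt ι
/-- Christoffel symbols `Γ p i j k = Γ^i_{jk}(p)` of a torsion-free affine connection. -/
abbrev Chr (ι : Type) := Pt ι → ι → ι → ι → ℝ

/-- Partial derivative in the `j`-th coordinate direction. -/
def pd (j : ι) (f : Pt ι → ℝ) (p : Pt ι) : ℝ :=
  fderiv ℝ f p (Pi.single j 1)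

/-- The covariant derivative `∇_X Y` of the affine connection with Christoffel symbols `Γ`. -/
def conn (Γ : Chr ι) (X Y : VF ι) : VF ι :=
  fun p i => fderiv ℝ (fun q => Y q i) p (X p) + ∑ j, ∑ k, Γ p i j k * X p j * Y p k

/-- The Lie bracket of vector fields. -/
def bracket (X Y : VF ι) : VF ι :=
  fun p i => fderiv ℝ (fun q => Y q i) p (X p) - fderiv ℝ (fun q => X q i) p (Y p)

/-- The curvature tensor `R(X,Y)Z = ∇_X∇_Y Z − ∇_Y∇_X Z − ∇_{[X,Y]}Z`. -/
def curv (Γ : Chr ι) (X Y Z : VF ι) : VF ι :=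
  conn Γ X (conn Γ Y Z) - conn Γ Y (conn Γ X Z) - conn Γ (bracket X Y) Z

/-- The covariant derivative of the curvature tensor,
`(∇_X R)(Y,Z)W = ∇_X(R(Y,Z)W) − R(∇_X Y,Z)W − R(Y,∇_X Z)W − R(Y,Z)∇_X W`. -/
def covCurv (Γ : Chr ι) (X Y Z W : VF ι) : VF ι :=
  conn Γ X (curv Γ Y Z W) - curv Γ (conn Γ X Y) Z W - curv Γ Y (conn Γ X Z) W
    - curv Γ Y Z (conn Γ X W)

/-- The affine Szabó operator `S(X)Y = (∇_X R)(Y,X)X`. -/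
def szabo (Γ : Chr ι) (X Y : VF ι) : VF ι := covCurv Γ X Y X X

/-- The constant vector field extending a tangent vector `v`. -/
def cvf (v : Pt ι) : VF ι := fun _ => v

/-- The matrix of the affine Szabó operator `S(X)` at the point `p` with respect to the
tangent vector `X = v`, in the coordinate basis. -/
def szaboMat (Γ : Chr ι) (p v : Pt ι) : Matrix ι ι ℝ :=
  Matrix.of fun i m => szabo Γ (cvf v) (cvf (Pi.single m 1)) p i

/-- The Ricci tensor `Ric(X,Y) = trace (Z ↦ R(Z,X)Y)`. -/
def ricci (Γ : Chr ι) (X Y : VF ι) (p : Pt ι) : ℝ :=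
  ∑ i, curv Γ (cvf (Pi.single i 1)) X Y p i

/-- The covariant derivative of the Ricci tensor,
`(∇_X Ric)(Z,W) = X(Ric(Z,W)) − Ric(∇_X Z,W) − Ric(Z,∇_X W)`. -/
def covRic (Γ : Chr ι) (X Z W : VF ι) (p : Pt ι) : ℝ :=
  fderiv ℝ (ricci Γ Z W) p (X p) - ricci Γ (conn Γ X Z) W p - ricci Γ Z (conn Γ X W) p

/-- A vector field is smooth if its components are smooth. -/
def SmoothVF (X : VF ι) : Prop := ∀ i, ContDiff ℝ (⊤ : ℕ∞) fun p => X p i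

/-- A connection is smooth if its Christoffel symbols are smooth. -/
def SmoothChr (Γ : Chr ι) : Prop := ∀ i j k, ContDiff ℝ (⊤ : ℕ∞) fun p => Γ p i j k

/-- The Ricci tensor of `Γ` is cyclic parallel: `(∇_X Ric)(X,X) = 0` for all vector fields `X`. -/
def CyclicParallelRic (Γ : Chr ι) : Prop :=
  ∀ X : VF ι, SmoothVF X → ∀ p, covRic Γ X X X p = 0

/-- The connection is affine Szabó: every affine Szabó operator is nilpotent. -/
def AffineSzabo (Γ : Chr ι) : Prop :=
  ∀ p v : Pt ι, IsNilpotent (szaboMat Γ p v)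


/-- The Riemannian-extension metric of signature `(3,3)` on `ℝ⁶`:
`g = 2dx₁dx₄ + 2dx₂dx₅ + 2dx₃dx₆ − 2x₁x₄ dx₁² − 4x₃x₄ dx₁dx₂ + 4x₂x₄ dx₁dx₃`. -/
def gmet (p : Pt (Fin 6)) : Matrix (Fin 6) (Fin 6) ℝ :=
  !![-2 * p 0 * p 3, -2 * p 2 * p 3, 2 * p 1 * p 3, 1, 0, 0;
     -2 * p 2 * p 3, 0, 0, 0, 1, 0;
     2 * p 1 * p 3, 0, 0, 0, 0, 1;
     1, 0, 0, 0, 0, 0;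
     0, 1, 0, 0, 0, 0;
     0, 0, 1, 0, 0, 0]

/-- The Christoffel symbols of the Levi-Civita connection of `gmet`:
`Γ^i_{jk} = ½ g^{il}(∂_j g_{lk} + ∂_k g_{lj} − ∂_l g_{jk})`. -/
def gammaLC : Chr (Fin 6) := fun p i j k =>
  (1 / 2) * ∑ l, (gmet p)⁻¹ i l *
    (pd j (fun q => gmet q l k) p + pd k (fun q => gmet q l j) p - pd l (fun q => gmet q j k) p)

section General

variable {ι : Type} [Fintype ι]

/-- The bilinear map `(X, Y) ↦ Γ(X, Y)` defined by the Christoffel symbols at `p`. -/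
def chrForm (Γ : Chr ι) (p X Y : Pt ι) : Pt ι :=
  fun i => ∑ j, ∑ k, Γ p i j k * X j * Y k

/-- The derivative of `chrForm` in the direction `u`. -/
def chrFormDeriv (Γ : Chr ι) (p u X Y : Pt ι) : Pt ι :=
  fun i => ∑ j, ∑ k, fderiv ℝ (fun q => Γ q i j k) p u * X j * Y k

/-- The curvature tensor as a pointwise trilinear expression in the Christoffel symbols. -/
def riem (Γ : Chr ι) (p X Y Z : Pt ι) : Pt ι :=
  chrFormDeriv Γ p X Y Z - chrFormDeriv Γ p Y X Z
    + chrForm Γ p X (chrForm Γ p Y Z) - chrForm Γ p Y (chrForm Γ p X Z)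

theorem chrForm_sub_left (Γ : Chr ι) (p X X' Y : Pt ι) :
    chrForm Γ p (X - X') Y = chrForm Γ p X Y - chrForm Γ p X' Y := by
  ext i
  simp only [chrForm, Pi.sub_apply, ← Finset.sum_sub_distrib]
  exact Finset.sum_congr rfl fun j _ => Finset.sum_congr rfl fun k _ => by ring

theorem chrForm_add_right (Γ : Chr ι) (p X Y Y' : Pt ι) :
    chrForm Γ p X (Y + Y') = chrForm Γ p X Y + chrForm Γ p X Y' := by
  ext i
  simp only [chrForm, Pi.add_apply, ← Finset.sum_add_distrib]
  exact Finset.sum_congr rfl fun j _ => Finset.sum_congr rfl fun k _ => by ring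

theorem SmoothVF.contDiff {X : VF ι} (hX : SmoothVF X) : ContDiff ℝ (⊤ : ℕ∞) X :=
  contDiff_pi.2 hX

theorem smoothVF_of_contDiff {X : VF ι} (hX : ContDiff ℝ (⊤ : ℕ∞) X) : SmoothVF X :=
  contDiff_pi.1 hX

theorem SmoothVF.differentiableAt {X : VF ι} (hX : SmoothVF X) (p : Pt ι) :
    DifferentiableAt ℝ X p :=
  hX.contDiff.differentiable (by simp) p

theorem fderiv_component {X : VF ι} {p : Pt ι} (hX : DifferentiableAt ℝ X p) (u : Pt ι) (i : ι) :
    fderiv ℝ (fun q => X q i) p u = fderiv ℝ X p u i := by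
  rw [(hasFDerivAt_pi'.1 hX.hasFDerivAt i).fderiv]
  rfl

theorem conn_eq (Γ : Chr ι) (X : VF ι) {Y : VF ι} (hY : SmoothVF Y) (p : Pt ι) :
    conn Γ X Y p = fderiv ℝ Y p (X p) + chrForm Γ p (X p) (Y p) := by
  ext i
  rw [Pi.add_apply, ← fderiv_component (hY.differentiableAt p)]
  rfl

theorem bracket_eq {X Y : VF ι} (hX : SmoothVF X) (hY : SmoothVF Y) (p : Pt ι) :
    bracket X Y p = fderiv ℝ Y p (X p) - fderiv ℝ X p (Y p) := by
  ext i
  rw [Pi.sub_apply, ← fderiv_component (hY.differentiableAt p),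
    ← fderiv_component (hX.differentiableAt p)]
  rfl

theorem SmoothChr.contDiff_chrForm {Γ : Chr ι} (hΓ : SmoothChr Γ) {X Y : VF ι}
    (hX : SmoothVF X) (hY : SmoothVF Y) :
    ContDiff ℝ (⊤ : ℕ∞) fun p => chrForm Γ p (X p) (Y p) :=
  contDiff_pi.2 fun i => ContDiff.sum fun j _ => ContDiff.sum fun k _ =>
    ((hΓ i j k).mul (hX j)).mul (hY k)

theorem SmoothVF.contDiff_fderiv {X Y : VF ι} (hX : SmoothVF X) (hY : SmoothVF Y) :
    ContDiff ℝ (⊤ : ℕ∞) fun p => fderiv ℝ Y p (X p) :=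
  (hY.contDiff.fderiv_right (m := (⊤ : ℕ∞)) (by simp)).clm_apply hX.contDiff

theorem SmoothChr.smoothVF_conn {Γ : Chr ι} (hΓ : SmoothChr Γ) {X Y : VF ι}
    (hX : SmoothVF X) (hY : SmoothVF Y) : SmoothVF (conn Γ X Y) := by
  rw [funext fun p => conn_eq Γ X hY p]
  exact smoothVF_of_contDiff ((hX.contDiff_fderiv hY).add (hΓ.contDiff_chrForm hX hY))

theorem SmoothVF.bracket {X Y : VF ι} (hX : SmoothVF X) (hY : SmoothVF Y) :
    SmoothVF (bracket X Y) := by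
  rw [funext fun p => bracket_eq hX hY p]
  exact smoothVF_of_contDiff ((hX.contDiff_fderiv hY).sub (hY.contDiff_fderiv hX))

theorem SmoothVF.fderiv_fderiv {X Y : VF ι} (hX : SmoothVF X) (hY : SmoothVF Y) (p u : Pt ι) :
    fderiv ℝ (fun q => fderiv ℝ Y q (X q)) p u
      = fderiv ℝ (fderiv ℝ Y) p u (X p) + fderiv ℝ Y p (fderiv ℝ X p u) := by
  have h1 : DifferentiableAt ℝ (fderiv ℝ Y) p :=
    (hY.contDiff.fderiv_right (m := (⊤ : ℕ∞)) (by simp)).differentiable (by simp) p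
  rw [fderiv_clm_apply h1 (hX.differentiableAt p)]
  simp [add_comm]

theorem SmoothChr.fderiv_chrForm {Γ : Chr ι} (hΓ : SmoothChr Γ) {X Y : VF ι}
    (hX : SmoothVF X) (hY : SmoothVF Y) (p u : Pt ι) :
    fderiv ℝ (fun q => chrForm Γ q (X q) (Y q)) p u
      = chrFormDeriv Γ p u (X p) (Y p) + chrForm Γ p (fderiv ℝ X p u) (Y p)
        + chrForm Γ p (X p) (fderiv ℝ Y p u) := by
  have dX := fun i => ((hX i).differentiable (by simp)) p
  have dY := fun i => ((hY i).differentiable (by simp)) p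
  have dΓ := fun i j k => ((hΓ i j k).differentiable (by simp)) p
  ext i
  rw [← fderiv_component ((hΓ.contDiff_chrForm hX hY).differentiable (by simp) p)]
  simp only [chrForm, chrFormDeriv, Pi.add_apply, ← Finset.sum_add_distrib]
  rw [fderiv_fun_sum fun j _ => DifferentiableAt.fun_sum fun k _ =>
    ((dΓ i j k).fun_mul (dX j)).fun_mul (dY k), sum_apply]
  refine Finset.sum_congr rfl fun j _ => ?_
  rw [fderiv_fun_sum fun k _ => ((dΓ i j k).fun_mul (dX j)).fun_mul (dY k),
    sum_apply]
  refine Finset.sum_congr rfl fun k _ => ?_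
  rw [fderiv_fun_mul ((dΓ i j k).fun_mul (dX j)) (dY k), fderiv_fun_mul (dΓ i j k) (dX j),
    ← fderiv_component (hX.differentiableAt p), ← fderiv_component (hY.differentiableAt p)]
  simp
  ring

theorem SmoothChr.fderiv_conn {Γ : Chr ι} (hΓ : SmoothChr Γ) {X Y : VF ι}
    (hX : SmoothVF X) (hY : SmoothVF Y) (p u : Pt ι) :
    fderiv ℝ (conn Γ X Y) p u
      = fderiv ℝ (fderiv ℝ Y) p u (X p) + fderiv ℝ Y p (fderiv ℝ X p u)
        + (chrFormDeriv Γ p u (X p) (Y p) + chrForm Γ p (fderiv ℝ X p u) (Y p)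
          + chrForm Γ p (X p) (fderiv ℝ Y p u)) := by
  rw [funext fun p => conn_eq Γ X hY p, fderiv_fun_add
    ((hX.contDiff_fderiv hY).differentiable (by simp) p)
    ((hΓ.contDiff_chrForm hX hY).differentiable (by simp) p),
    add_apply, hX.fderiv_fderiv hY, hΓ.fderiv_chrForm hX hY]

theorem SmoothChr.curv_eq {Γ : Chr ι} (hΓ : SmoothChr Γ) {X Y Z : VF ι}
    (hX : SmoothVF X) (hY : SmoothVF Y) (hZ : SmoothVF Z) (p : Pt ι) :
    curv Γ X Y Z p = riem Γ p (X p) (Y p) (Z p) := by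
  have hsymm : fderiv ℝ (fderiv ℝ Z) p (X p) (Y p) = fderiv ℝ (fderiv ℝ Z) p (Y p) (X p) :=
    (hZ.contDiff.contDiffAt.isSymmSndFDerivAt
      (by simp only [minSmoothness_of_isRCLikeNormedField]; exact WithTop.coe_le_coe.2 (le_top (a := (2 : ℕ∞))))).eq _ _
  simp only [curv, riem, Pi.sub_apply]
  rw [conn_eq Γ X (hΓ.smoothVF_conn hY hZ), conn_eq Γ Y (hΓ.smoothVF_conn hX hZ),
    conn_eq Γ (bracket X Y) hZ, hΓ.fderiv_conn hY hZ, hΓ.fderiv_conn hX hZ,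
    conn_eq Γ Y hZ, conn_eq Γ X hZ, bracket_eq hX hY, hsymm]
  simp only [chrForm_add_right, chrForm_sub_left, map_sub]
  abel

theorem SmoothChr.smoothVF_curv {Γ : Chr ι} (hΓ : SmoothChr Γ) {X Y Z : VF ι}
    (hX : SmoothVF X) (hY : SmoothVF Y) (hZ : SmoothVF Z) : SmoothVF (curv Γ X Y Z) :=
  smoothVF_of_contDiff
    (((hΓ.smoothVF_conn hX (hΓ.smoothVF_conn hY hZ)).contDiff.sub
      (hΓ.smoothVF_conn hY (hΓ.smoothVF_conn hX hZ)).contDiff).sub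
      (hΓ.smoothVF_conn (hX.bracket hY) hZ).contDiff)

theorem smoothVF_cvf (v : Pt ι) : SmoothVF (cvf v) := fun _ => contDiff_const

theorem conn_cvf (Γ : Chr ι) (v w p : Pt ι) : conn Γ (cvf v) (cvf w) p = chrForm Γ p v w := by
  rw [conn_eq Γ _ (smoothVF_cvf w), show fderiv ℝ (cvf w) p = 0 from fderiv_const_apply w]
  simp [cvf]

theorem SmoothChr.szabo_cvf {Γ : Chr ι} (hΓ : SmoothChr Γ) (v w p : Pt ι) (i : ι) :
    szabo Γ (cvf v) (cvf w) p i
      = fderiv ℝ (fun q => riem Γ q w v v i) p v + chrForm Γ p v (riem Γ p w v v) i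
        - riem Γ p (chrForm Γ p v w) v v i - riem Γ p w (chrForm Γ p v v) v i
        - riem Γ p w v (chrForm Γ p v v) i := by
  have hv := smoothVF_cvf v
  have hw := smoothVF_cvf w
  have hc := funext fun q => hΓ.curv_eq hw hv hv q
  simp only [szabo, covCurv, Pi.sub_apply]
  rw [hΓ.curv_eq (hΓ.smoothVF_conn hv hw) hv hv, hΓ.curv_eq hw (hΓ.smoothVF_conn hv hv) hv,
    hΓ.curv_eq hw hv (hΓ.smoothVF_conn hv hv), conn_cvf, conn_cvf, hc]
  rfl

end General

/-- The bilinear map given by the Christoffel symbols of `gmet`. -/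
def lcForm (p X Y : Pt (Fin 6)) : Pt (Fin 6) :=
  ![p 0 * X 0 * Y 0 + p 2 * (X 0 * Y 1 + X 1 * Y 0) - p 1 * (X 0 * Y 2 + X 2 * Y 0), 0, 0,
    2 * p 0 * p 3 * (p 0 * X 0 * Y 0 + p 2 * (X 0 * Y 1 + X 1 * Y 0)
        - p 1 * (X 0 * Y 2 + X 2 * Y 0))
      - p 3 * X 0 * Y 0 - p 0 * (X 0 * Y 3 + X 3 * Y 0) - p 2 * (X 1 * Y 3 + X 3 * Y 1)
      + p 1 * (X 2 * Y 3 + X 3 * Y 2),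
    2 * p 2 * p 3 * (p 0 * X 0 * Y 0 + p 2 * (X 0 * Y 1 + X 1 * Y 0)
        - p 1 * (X 0 * Y 2 + X 2 * Y 0))
      - 2 * p 3 * (X 0 * Y 2 + X 2 * Y 0) - p 2 * (X 0 * Y 3 + X 3 * Y 0),
    -2 * p 1 * p 3 * (p 0 * X 0 * Y 0 + p 2 * (X 0 * Y 1 + X 1 * Y 0)
        - p 1 * (X 0 * Y 2 + X 2 * Y 0))
      + 2 * p 3 * (X 0 * Y 1 + X 1 * Y 0) + p 1 * (X 0 * Y 3 + X 3 * Y 0)]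

/-- The bilinear form obtained by differentiating `gmet` at `p` in the direction `u`. -/
def gmetDeriv (p u X Y : Pt (Fin 6)) : ℝ :=
  -2 * (u 0 * p 3 + p 0 * u 3) * (X 0 * Y 0)
    - 2 * (u 2 * p 3 + p 2 * u 3) * (X 0 * Y 1 + X 1 * Y 0)
    + 2 * (u 1 * p 3 + p 1 * u 3) * (X 0 * Y 2 + X 2 * Y 0)

theorem fderiv_coord {ι : Type} [Fintype ι] (p u : Pt ι) (i : ι) :
    fderiv ℝ (fun q : Pt ι => q i) p u = u i := by
  rw [(hasFDerivAt_apply i p).fderiv]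
  rfl

theorem pd_gmet (j l k : Fin 6) (p : Pt (Fin 6)) :
    pd j (fun q => gmet q l k) p
      = gmetDeriv p (Pi.single j 1) (Pi.single l 1) (Pi.single k 1) := by
  unfold pd
  fin_cases l <;> fin_cases k <;> simp [gmet, gmetDeriv]
  all_goals
    simp (disch := fun_prop) [fderiv_fun_mul, fderiv_coord]
    try ring

theorem gmet_inv (p : Pt (Fin 6)) :
    (gmet p)⁻¹ = !![0, 0, 0, 1, 0, 0;
      0, 0, 0, 0, 1, 0;
      0, 0, 0, 0, 0, 1;
      1, 0, 0, 2 * p 0 * p 3, 2 * p 2 * p 3, -2 * p 1 * p 3;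
      0, 1, 0, 2 * p 2 * p 3, 0, 0;
      0, 0, 1, -2 * p 1 * p 3, 0, 0] := by
  refine Matrix.inv_eq_right_inv ?_
  ext i j
  fin_cases i <;> fin_cases j <;> simp [gmet, Matrix.mul_apply, Fin.sum_univ_six]

theorem gammaLC_eq (p : Pt (Fin 6)) (i j k : Fin 6) :
    gammaLC p i j k = lcForm p (Pi.single j 1) (Pi.single k 1) i := by
  simp only [gammaLC, gmet_inv, pd_gmet, Fin.sum_univ_six]
  fin_cases i
  all_goals
    simp [gmetDeriv, lcForm]
    try ring

theorem contDiff_lcForm (X Y : Pt (Fin 6)) (i : Fin 6) :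
    ContDiff ℝ (⊤ : ℕ∞) fun p => lcForm p X Y i := by
  fin_cases i <;> simp [lcForm] <;> fun_prop

theorem smoothChr_gammaLC : SmoothChr gammaLC := fun i j k => by
  simpa only [gammaLC_eq] using contDiff_lcForm _ _ i

theorem chrForm_gammaLC (p X Y : Pt (Fin 6)) : chrForm gammaLC p X Y = lcForm p X Y := by
  ext i
  simp only [chrForm, gammaLC_eq, Fin.sum_univ_six]
  fin_cases i <;> simp [lcForm] <;> ring

theorem chrFormDeriv_gammaLC (p u X Y : Pt (Fin 6)) (i : Fin 6) :
    chrFormDeriv gammaLC p u X Y i = fderiv ℝ (fun q => lcForm q X Y i) p u := by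
  have h := smoothChr_gammaLC.fderiv_chrForm (smoothVF_cvf X) (smoothVF_cvf Y) p u
  have hX : ∀ X : Pt (Fin 6), fderiv ℝ (cvf X) p = 0 := fun X => fderiv_const_apply X
  have h0 : ∀ Z : Pt (Fin 6), chrForm gammaLC p 0 Z = 0 ∧ chrForm gammaLC p Z 0 = 0 :=
    fun Z => ⟨by ext; simp [chrForm], by ext; simp [chrForm]⟩
  simp only [hX, zero_apply, (h0 _).1, (h0 _).2, add_zero, chrForm_gammaLC] at h
  rw [fderiv_component (differentiableAt_pi.2 fun i =>
    (contDiff_lcForm X Y i).differentiable (by simp) p)]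
  exact (congrFun h i).symm

theorem riem_gammaLC_zero (p X Y Z : Pt (Fin 6)) :
    riem gammaLC p X Y Z 0 =
      (X 0 * Y 1 - X 1 * Y 0) * (Z 2 + p 1 * p 2 * Z 2 - p 2 ^ 2 * Z 1)
      + (X 0 * Y 2 - X 2 * Y 0) * (-Z 1 + p 1 * p 2 * Z 1 - p 1 ^ 2 * Z 2)
      - 2 * (X 1 * Y 2 - X 2 * Y 1) * Z 0 := by
  simp only [riem, Pi.add_apply, Pi.sub_apply, chrFormDeriv_gammaLC, chrForm_gammaLC]
  simp [lcForm]
  simp (disch := fun_prop) [fderiv_fun_mul, fderiv_fun_add, fderiv_fun_sub, fderiv_coord]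
  ring

theorem riem_gammaLC_one (p X Y Z : Pt (Fin 6)) : riem gammaLC p X Y Z 1 = 0 := by
  simp only [riem, Pi.add_apply, Pi.sub_apply, chrFormDeriv_gammaLC, chrForm_gammaLC]
  simp [lcForm]

theorem riem_gammaLC_two (p X Y Z : Pt (Fin 6)) : riem gammaLC p X Y Z 2 = 0 := by
  simp only [riem, Pi.add_apply, Pi.sub_apply, chrFormDeriv_gammaLC, chrForm_gammaLC]
  simp [lcForm]

theorem riem_gammaLC_three {X : Pt (Fin 6)} (h0 : X 0 = 0) (h1 : X 1 = 0) (h2 : X 2 = 0)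
    (p Y Z : Pt (Fin 6)) :
    riem gammaLC p X Y Z 3 = X 3 * (Z 1 * (Y 2 + p 1 * p 2 * Y 2 - p 2 ^ 2 * Y 1)
      + Z 2 * (-Y 1 + p 1 * p 2 * Y 1 - p 1 ^ 2 * Y 2)) := by
  simp only [riem, Pi.add_apply, Pi.sub_apply, chrFormDeriv_gammaLC, chrForm_gammaLC]
  simp [lcForm, h0, h1, h2]
  simp (disch := fun_prop) [fderiv_fun_mul, fderiv_fun_add, fderiv_fun_sub, fderiv_coord,
    h0, h1, h2]
  ring

theorem riem_gammaLC_eq_zero {X : Pt (Fin 6)} (h0 : X 0 = 0) (h1 : X 1 = 0) (h2 : X 2 = 0)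
    (h3 : X 3 = 0) (p Y Z : Pt (Fin 6)) : riem gammaLC p X Y Z = 0 := by
  ext i
  simp only [riem, Pi.add_apply, Pi.sub_apply, chrFormDeriv_gammaLC, chrForm_gammaLC]
  fin_cases i <;> simp [lcForm, h0, h1, h2, h3] <;>
    simp (disch := fun_prop) [fderiv_fun_mul, fderiv_fun_add, fderiv_fun_sub, fderiv_coord,
      h0, h1, h2, h3]

theorem szaboMat_gammaLC_apply (p v : Pt (Fin 6)) (i m : Fin 6) :
    szaboMat gammaLC p v i m
      = fderiv ℝ (fun q => riem gammaLC q (Pi.single m 1) v v i) p v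
        + lcForm p v (riem gammaLC p (Pi.single m 1) v v) i
        - riem gammaLC p (lcForm p v (Pi.single m 1)) v v i
        - riem gammaLC p (Pi.single m 1) (lcForm p v v) v i
        - riem gammaLC p (Pi.single m 1) v (lcForm p v v) i := by
  simp only [← chrForm_gammaLC]
  exact smoothChr_gammaLC.szabo_cvf v (Pi.single m 1) p i

theorem szaboMat_gammaLC_one (p v : Pt (Fin 6)) (m : Fin 6) : szaboMat gammaLC p v 1 m = 0 := by
  simp [szaboMat_gammaLC_apply, riem_gammaLC_one, lcForm]

theorem szaboMat_gammaLC_two (p v : Pt (Fin 6)) (m : Fin 6) : szaboMat gammaLC p v 2 m = 0 := by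
  simp [szaboMat_gammaLC_apply, riem_gammaLC_two, lcForm]

theorem szaboMat_gammaLC_zero_zero (p v : Pt (Fin 6)) : szaboMat gammaLC p v 0 0 = 0 := by
  simp only [szaboMat_gammaLC_apply, riem_gammaLC_zero]
  simp [riem_gammaLC_zero, riem_gammaLC_one, riem_gammaLC_two, lcForm]
  simp (disch := fun_prop) [fderiv_fun_mul, fderiv_fun_add, fderiv_fun_sub, fderiv_coord,
    fderiv_fun_pow]
  ring

theorem szaboMat_gammaLC_zero_three (p v : Pt (Fin 6)) : szaboMat gammaLC p v 0 3 = 0 := by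
  simp only [szaboMat_gammaLC_apply, riem_gammaLC_zero]
  simp [riem_gammaLC_zero, riem_gammaLC_one, riem_gammaLC_two, lcForm]

theorem szaboMat_gammaLC_three_three (p v : Pt (Fin 6)) : szaboMat gammaLC p v 3 3 = 0 := by
  have h : ∀ q Y Z, riem gammaLC q (Pi.single 3 1) Y Z 3
      = Z 1 * (Y 2 + q 1 * q 2 * Y 2 - q 2 ^ 2 * Y 1)
        + Z 2 * (-Y 1 + q 1 * q 2 * Y 1 - q 1 ^ 2 * Y 2) := fun q Y Z => by
    rw [riem_gammaLC_three (by simp) (by simp) (by simp)]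
    simp
  rw [szaboMat_gammaLC_apply, riem_gammaLC_three (X := lcForm p v (Pi.single 3 1))
    (by simp [lcForm]) (by simp [lcForm]) (by simp [lcForm])]
  simp [h, riem_gammaLC_zero, riem_gammaLC_one, riem_gammaLC_two, lcForm]
  simp (disch := fun_prop) [fderiv_fun_mul, fderiv_fun_add, fderiv_fun_sub, fderiv_coord,
    fderiv_fun_pow]
  ring

theorem szaboMat_gammaLC_four (p v : Pt (Fin 6)) (i : Fin 6) : szaboMat gammaLC p v i 4 = 0 := by
  have h := @riem_gammaLC_eq_zero (Pi.single 4 1) (by simp) (by simp) (by simp) (by simp)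
  rw [szaboMat_gammaLC_apply, riem_gammaLC_eq_zero (X := lcForm p v (Pi.single 4 1))
    (by simp [lcForm]) (by simp [lcForm]) (by simp [lcForm]) (by simp [lcForm])]
  fin_cases i <;> simp [h, lcForm]

theorem szaboMat_gammaLC_five (p v : Pt (Fin 6)) (i : Fin 6) : szaboMat gammaLC p v i 5 = 0 := by
  have h := @riem_gammaLC_eq_zero (Pi.single 5 1) (by simp) (by simp) (by simp) (by simp)
  rw [szaboMat_gammaLC_apply, riem_gammaLC_eq_zero (X := lcForm p v (Pi.single 5 1))
    (by simp [lcForm]) (by simp [lcForm]) (by simp [lcForm]) (by simp [lcForm])]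
  fin_cases i <;> simp [h, lcForm]

/-- The metric `gmet` is a Szabó metric: every Szabó operator of its Levi-Civita connection
is nilpotent. -/
theorem gmet_is_szabo : ∀ p v : Pt (Fin 6), IsNilpotent (szaboMat gammaLC p v) := by
  intro p v
  have h1 := szaboMat_gammaLC_one p v
  have h2 := szaboMat_gammaLC_two p v
  have h00 := szaboMat_gammaLC_zero_zero p v
  have h03 := szaboMat_gammaLC_zero_three p v
  have h33 := szaboMat_gammaLC_three_three p v
  have h4 := szaboMat_gammaLC_four p v
  have h5 := szaboMat_gammaLC_five p v
  generalize szaboMat gammaLC p v = M at *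
  refine ⟨4, ?_⟩
  have hM : M ^ 4 = M * M * (M * M) := by noncomm_ring
  rw [hM]
  ext i m
  fin_cases i <;>
    simp [Matrix.mul_apply, Fin.sum_univ_six, h1, h2, h00, h03, h33, h4, h5]

end AffineSzabo
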